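/- Let (X, A_X) be a finite network with n nodes, with dissimilarities arranged in the n×n matrix A_X, and let t ≥ 2 be an integer. Then the t-th semi-reciprocal ultrametric can be computed via dioid matrix powers as u^{SR(t)}_X = (max(A_X^{t−1}, (A_X^T)^{t−1}))^{n−1}, where all powers are dioid powers in the min-max dioid algebra and the maximum of matrices is taken entrywise. -/

import Mathlib

noncomputable section

/-- Cost of a chain (a finite ordered list of nodes): the maximum dissimilarity
encountered over consecutive pairs (0 for chains with fewer than two nodes). -/
def chainCost {X : Type*} (A : X → X → ℝ) : List X → ℝ
  | [] => 0
  | [_] => 0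
  | a :: b :: rest => max (A a b) (chainCost A (b :: rest))

/-- The set of costs of chains from `x` to `x'`. -/
def chainCosts {X : Type*} (A : X → X → ℝ) (x x' : X) : Set ℝ :=
  { c | ∃ l : List X, l.head? = some x ∧ l.getLast? = some x' ∧ chainCost A l = c }

/-- Directed minimum chain cost ũ*(x,x'). -/
def minChainCost {X : Type*} (A : X → X → ℝ) (x x' : X) : ℝ :=
  sInf (chainCosts A x x')

/-- The reciprocal ultrametric u^R. -/
def uR {X : Type*} (A : X → X → ℝ) (x x' : X) : ℝ :=
  minChainCost (fun a b => max (A a b) (A b a)) x x'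

/-- The nonreciprocal ultrametric u^NR. -/
def uNR {X : Type*} (A : X → X → ℝ) (x x' : X) : ℝ :=
  max (minChainCost A x x') (minChainCost A x' x)

/-- The set of costs of chains from `x` to `x'` having at most `t` nodes. -/
def boundedChainCosts {X : Type*} (A : X → X → ℝ) (t : ℕ) (x x' : X) : Set ℝ :=
  { c | ∃ l : List X, l.head? = some x ∧ l.getLast? = some x' ∧ l.length ≤ t ∧
      chainCost A l = c }

/-- A^{SR(t)}(x,x'): minimum cost over chains from `x` to `x'` with at most `t` nodes. -/
def ASR {X : Type*} (A : X → X → ℝ) (t : ℕ) (x x' : X) : ℝ :=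
  sInf (boundedChainCosts A t x x')

/-- The semi-reciprocal ultrametric u^{SR(t)}. -/
def uSR {X : Type*} (A : X → X → ℝ) (t : ℕ) (x x' : X) : ℝ :=
  minChainCost (fun a b => max (ASR A t a b) (ASR A t b a)) x x'

/-- The min-max dioid product of square matrices. -/
def dioidMul {n : ℕ} (A B : Fin n → Fin n → ℝ) : Fin n → Fin n → ℝ :=
  fun i j => ⨅ k : Fin n, max (A i k) (B k j)

/-- Dioid powers: `dioidPow A l` is the `l`-th power `A^l` of `A` in the min-max
dioid algebra (with the convention `A^0 = A`, which is never used for `l ≥ 1`). -/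
def dioidPow {n : ℕ} (A : Fin n → Fin n → ℝ) : ℕ → Fin n → Fin n → ℝ
  | 0 => A
  | 1 => A
  | (k + 2) => dioidMul A (dioidPow A (k + 1))

lemma chainCost_nonneg {X : Type*} {A : X → X → ℝ} (hA : ∀ i j, 0 ≤ A i j) :
    ∀ l : List X, 0 ≤ chainCost A l
  | [] => le_rfl
  | [_] => le_rfl
  | a :: b :: _ => le_max_of_le_left (hA a b)

lemma chainCost_le_iff {X : Type*} {A : X → X → ℝ} {c : ℝ} (hc : 0 ≤ c) :
    ∀ l : List X, chainCost A l ≤ c ↔ l.IsChain (fun a b => A a b ≤ c)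
  | [] => by simp [chainCost, hc]
  | [_] => by simp [chainCost, hc]
  | a :: b :: l => by
    rw [chainCost, max_le_iff, chainCost_le_iff hc (b :: l), List.isChain_cons_cons]

lemma chainCost_reverse_le {X : Type*} {A : X → X → ℝ} (hA : ∀ i j, 0 ≤ A i j) (l : List X) :
    chainCost (fun p q => A q p) l.reverse ≤ chainCost A l := by
  have hc := chainCost_nonneg hA l
  rw [chainCost_le_iff hc, List.isChain_reverse]
  exact (chainCost_le_iff hc l).1 le_rfl

/-- Loops can be removed from a chain without creating new links. -/
lemma exists_nodup_isChain {X : Type*} (R : X → X → Prop) (y : X) :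
    ∀ (l : List X) (x : X), l.head? = some x → l.getLast? = some y → l.IsChain R →
      ∃ l' : List X, l'.head? = some x ∧ l'.getLast? = some y ∧ l'.Nodup ∧ l'.IsChain R
  | [], _, h, _, _ => by simp at h
  | [a], _, h, h', hR => ⟨[a], h, h', by simp, hR⟩
  | a :: b :: l, x, h, h', hR => by
    obtain rfl : a = x := by simpa using h
    rw [List.isChain_cons_cons] at hR
    obtain ⟨l', hb, hy, hn, hc⟩ :=
      exists_nodup_isChain R y (b :: l) b rfl (by simpa using h') hR.2
    by_cases ha : a ∈ l'
    · obtain ⟨s, r, rfl⟩ := List.append_of_mem ha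
      have hs : a :: r <:+ s ++ a :: r := List.suffix_append _ _
      refine ⟨a :: r, rfl, ?_, hn.sublist hs.sublist, hc.suffix hs⟩
      simpa [List.getLast?_append] using hy
    · obtain ⟨d, r, rfl⟩ : ∃ d r, l' = d :: r := by
        cases l' with
        | nil => simp at hb
        | cons d r => exact ⟨d, r, rfl⟩
      obtain rfl : d = b := by simpa using hb
      refine ⟨a :: d :: r, rfl, by simpa using hy, List.nodup_cons.2 ⟨ha, hn⟩, ?_⟩
      exact List.isChain_cons_cons.2 ⟨hR.1, hc⟩

lemma dioidMul_le {n : ℕ} (A B : Fin n → Fin n → ℝ) (i k j : Fin n) :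
    dioidMul A B i j ≤ max (A i k) (B k j) :=
  ciInf_le (Set.finite_range _).bddBelow k

lemma exists_dioidMul_eq {n : ℕ} (A B : Fin n → Fin n → ℝ) (i j : Fin n) :
    ∃ k, max (A i k) (B k j) = dioidMul A B i j :=
  haveI : Nonempty (Fin n) := ⟨i⟩
  exists_eq_ciInf_of_finite

lemma exists_chainCost_eq_dioidPow {n : ℕ} {A : Fin n → Fin n → ℝ} (hA : ∀ i j, 0 ≤ A i j)
    (j : Fin n) : ∀ (k : ℕ) (i : Fin n), ∃ l : List (Fin n), (i :: l).getLast? = some j ∧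
      l.length = k + 1 ∧ chainCost A (i :: l) = dioidPow A (k + 1) i j
  | 0, i => ⟨[j], by simp, rfl, by simp [chainCost, dioidPow, hA]⟩
  | k + 1, i => by
    obtain ⟨m, hm⟩ := exists_dioidMul_eq A (dioidPow A (k + 1)) i j
    obtain ⟨l, hl, hlen, hcost⟩ := exists_chainCost_eq_dioidPow hA j k m
    refine ⟨m :: l, by simpa using hl, by simp [hlen], ?_⟩
    rw [chainCost, hcost, hm, dioidPow]

lemma dioidPow_le_chainCost {n : ℕ} {A : Fin n → Fin n → ℝ} (hd : ∀ i, A i i = 0)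
    (j : Fin n) : ∀ (k : ℕ) (i : Fin n) (l : List (Fin n)), l.head? = some i →
      l.getLast? = some j → l.length ≤ k + 2 → dioidPow A (k + 1) i j ≤ chainCost A l
  | _, _, [], h, _, _ => by simp at h
  | 0, i, [a], h, h', _ => by
    obtain rfl : a = i := by simpa using h
    obtain rfl : a = j := by simpa using h'
    simp [dioidPow, chainCost, hd]
  | 0, i, [a, b], h, h', _ => by
    obtain rfl : a = i := by simpa using h
    obtain rfl : b = j := by simpa using h'
    exact le_max_left _ _
  | 0, _, _ :: _ :: _ :: _, _, _, hl => by simp at hl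
  | k + 1, i, [a], h, h', _ => by
    refine (dioidMul_le A _ i i j).trans (max_le ?_ ?_)
    · exact (hd i).le
    · exact dioidPow_le_chainCost hd j k i [a] h h' (by simp)
  | k + 1, i, a :: b :: l, h, h', hl => by
    obtain rfl : a = i := by simpa using h
    refine (dioidMul_le A _ a b j).trans (max_le_max le_rfl ?_)
    exact dioidPow_le_chainCost hd j k b (b :: l) rfl (by simpa using h') (by simpa using hl)

lemma isLeast_boundedChainCosts {n : ℕ} {A : Fin n → Fin n → ℝ} (hA : ∀ i j, 0 ≤ A i j)
    (hd : ∀ i, A i i = 0) (k : ℕ) (i j : Fin n) :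
    IsLeast (boundedChainCosts A (k + 2) i j) (dioidPow A (k + 1) i j) := by
  constructor
  · obtain ⟨l, hl, hlen, hcost⟩ := exists_chainCost_eq_dioidPow hA j k i
    exact ⟨i :: l, rfl, hl, by simp [hlen], hcost⟩
  · rintro _ ⟨l, hi, hj, hlen, rfl⟩
    exact dioidPow_le_chainCost hd j k i l hi hj hlen

lemma dioidPow_nonneg {n : ℕ} {A : Fin n → Fin n → ℝ} (hA : ∀ i j, 0 ≤ A i j) (k : ℕ)
    (i j : Fin n) : 0 ≤ dioidPow A (k + 1) i j := by
  obtain ⟨l, -, -, hcost⟩ := exists_chainCost_eq_dioidPow hA j k i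
  exact hcost ▸ chainCost_nonneg hA _

lemma dioidPow_self {n : ℕ} {A : Fin n → Fin n → ℝ} (hA : ∀ i j, 0 ≤ A i j)
    (hd : ∀ i, A i i = 0) (k : ℕ) (i : Fin n) : dioidPow A (k + 1) i i = 0 :=
  le_antisymm (dioidPow_le_chainCost hd i k i [i] rfl rfl (by simp)) (dioidPow_nonneg hA k i i)

lemma dioidPow_transpose_le {n : ℕ} {A : Fin n → Fin n → ℝ} (hA : ∀ i j, 0 ≤ A i j)
    (hd : ∀ i, A i i = 0) (k : ℕ) (i j : Fin n) :
    dioidPow (fun p q => A q p) (k + 1) i j ≤ dioidPow A (k + 1) j i := by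
  obtain ⟨l, hl, hlen, hcost⟩ := exists_chainCost_eq_dioidPow hA i k j
  rw [← hcost]
  refine le_trans ?_ (chainCost_reverse_le hA (j :: l))
  refine dioidPow_le_chainCost (A := fun p q => A q p) hd j k i _ ?_ ?_ (by simp [hlen])
  · rw [List.head?_reverse, hl]
  · rw [List.getLast?_reverse, List.head?_cons]

lemma dioidPow_transpose {n : ℕ} {A : Fin n → Fin n → ℝ} (hA : ∀ i j, 0 ≤ A i j)
    (hd : ∀ i, A i i = 0) (k : ℕ) (i j : Fin n) :
    dioidPow (fun p q => A q p) (k + 1) i j = dioidPow A (k + 1) j i :=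
  le_antisymm (dioidPow_transpose_le hA hd k i j)
    (dioidPow_transpose_le (A := fun p q => A q p) (fun p q => hA q p) hd k j i)

/-- Unrestricted minimum chain costs are attained by the `(n - 1)`-th dioid power. -/
lemma isLeast_chainCosts {n : ℕ} {B : Fin n → Fin n → ℝ} (hB : ∀ i j, 0 ≤ B i j)
    (hd : ∀ i, B i i = 0) (i j : Fin n) :
    IsLeast (chainCosts B i j) (dioidPow B (n - 1) i j) := by
  match n, B, hB, hd, i, j with
  | 0, _, _, _, i, _ => exact i.elim0
  | 1, B, hB, hd, i, j =>
    obtain rfl : i = j := Subsingleton.elim _ _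
    rw [show dioidPow B (1 - 1) i i = 0 from hd i]
    refine ⟨⟨[i], rfl, rfl, rfl⟩, ?_⟩
    rintro _ ⟨l, -, -, rfl⟩
    exact chainCost_nonneg hB l
  | k + 2, B, hB, hd, i, j =>
    constructor
    · obtain ⟨l, hl, -, hcost⟩ := exists_chainCost_eq_dioidPow hB j k i
      exact ⟨i :: l, rfl, hl, hcost⟩
    · rintro _ ⟨l, hi, hj, rfl⟩
      have hc := chainCost_nonneg hB l
      obtain ⟨l', hi', hj', hn, hR⟩ :=
        exists_nodup_isChain _ j l i hi hj ((chainCost_le_iff hc l).1 le_rfl)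
      refine le_trans ?_ ((chainCost_le_iff hc l').2 hR)
      exact dioidPow_le_chainCost hd j k i l' hi' hj' (by simpa using hn.length_le_card)

/-- for every integer t ≥ 2, the t-th semi-reciprocal ultrametric
equals the (n−1)-th dioid power of the entrywise maximum
max(A^{t−1}, (Aᵀ)^{t−1}) of dioid powers. -/
theorem semireciprocal_eq_dioid_power (n : ℕ) (A : Fin n → Fin n → ℝ)
    (hnonneg : ∀ i j : Fin n, 0 ≤ A i j)
    (hid : ∀ i j : Fin n, A i j = 0 ↔ i = j)
    (t : ℕ) (ht : 2 ≤ t) :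
    ∀ i j : Fin n,
      uSR A t i j =
        dioidPow
          (fun a b =>
            max (dioidPow A (t - 1) a b) (dioidPow (fun p q => A q p) (t - 1) a b))
          (n - 1) i j := by
  intro i j
  obtain ⟨k, rfl⟩ := Nat.exists_eq_add_of_le' ht
  have hd : ∀ i, A i i = 0 := fun i => (hid i i).2 rfl
  have hASR : ∀ a b, ASR A (k + 2) a b = dioidPow A (k + 1) a b := fun a b =>
    (isLeast_boundedChainCosts hnonneg hd k a b).csInf_eq
  simp only [uSR, minChainCost, hASR, show k + 2 - 1 = k + 1 from rfl,
    dioidPow_transpose hnonneg hd]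
  refine (isLeast_chainCosts ?_ ?_ i j).csInf_eq
  · exact fun a b => le_max_of_le_left (dioidPow_nonneg hnonneg k a b)
  · exact fun a => by simp [dioidPow_self hnonneg hd]
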